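/- Let A_{-1}, A_0, A_1, G be as in the context, with G𝟙 = 𝟙, and let σ < 1 be a real number such that (A_{-1} − A_1)𝟙 ≥ (1 − σ)𝟙 entrywise. Then there is a unique sequence X : ℕ → B(ℓ∞) such that X_0 = 0 and, for every k, the operator I − A_0 − A_1X_k is invertible in B(ℓ∞) and X_{k+1} = (I − A_0 − A_1X_k)^{-1} A_{-1}; moreover this sequence satisfies, for every k: (i) 0 ≤ X_k ≤ X_{k+1} ≤ G; (ii) ‖G − X_{k+1}‖ ≤ ‖(I − A_0 − A_1G)^{-1} A_1‖ · ‖G − X_k‖; and (iii) ‖G − X_k‖ → 0 as k → ∞. -/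

import Mathlib

open BoundedContinuousFunction Filter

noncomputable section

/-- ℓ∞: the Banach space of bounded real sequences with the sup norm. -/
abbrev Linf : Type := BoundedContinuousFunction ℕ ℝ

/-- A sequence is nonnegative if all its entries are nonnegative. -/
def vnonneg (x : Linf) : Prop := ∀ i, 0 ≤ x i

/-- An operator in B(ℓ∞) is positive if it maps nonnegative sequences to
nonnegative sequences. -/
def OpPos (A : Linf →L[ℝ] Linf) : Prop := ∀ x : Linf, vnonneg x → vnonneg (A x)

/-- The constant sequence with all entries equal to one. -/
def ones : Linf := BoundedContinuousFunction.const ℕ (1 : ℝ)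

lemma OpPos.mul {A B : Linf →L[ℝ] Linf} (hA : OpPos A) (hB : OpPos B) : OpPos (A * B) :=
  fun x hx => hA _ (hB x hx)

lemma OpPos.add {A B : Linf →L[ℝ] Linf} (hA : OpPos A) (hB : OpPos B) : OpPos (A + B) :=
  fun x hx i => add_nonneg (hA x hx i) (hB x hx i)

lemma OpPos.sub_zero {A : Linf →L[ℝ] Linf} (hA : OpPos A) : OpPos (A - 0) :=
  fun x hx i => (hA x hx i).trans_eq (_root_.sub_zero (A x i)).symm

lemma vnonneg_ones : vnonneg ones := fun _ => zero_le_one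

lemma OpPos.apply_le {A : Linf →L[ℝ] Linf} (hA : OpPos A) {x y : Linf}
    (h : ∀ i, x i ≤ y i) (i : ℕ) : A x i ≤ A y i := by
  have := hA (y - x) (fun j => sub_nonneg.2 (h j)) i
  rw [map_sub] at this
  exact sub_nonneg.1 this

lemma apply_smul_ones (A : Linf →L[ℝ] Linf) (c : ℝ) (i : ℕ) :
    A (c • ones) i = c * A ones i := by
  rw [map_smul]; rfl

lemma smul_ones_apply (c : ℝ) (i : ℕ) : (c • ones) i = c := mul_one c

/-- A positive operator on `ℓ∞` attains its norm on the constant sequence one. -/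
lemma OpPos.norm_le {A : Linf →L[ℝ] Linf} (hA : OpPos A) {c : ℝ}
    (h : ∀ i, A ones i ≤ c) : ‖A‖ ≤ c := by
  have hc : 0 ≤ c := (hA ones vnonneg_ones 0).trans (h 0)
  refine A.opNorm_le_bound hc fun x => ?_
  refine (BoundedContinuousFunction.norm_le (by positivity)).2 fun i => ?_
  have hx : ∀ j, |x j| ≤ ‖x‖ := fun j => x.norm_coe_le_norm j
  have h1 := hA.apply_le (x := x) (y := ‖x‖ • ones)
    (fun j => by rw [smul_ones_apply]; exact (abs_le.1 (hx j)).2) i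
  have h2 := hA.apply_le (x := (-‖x‖) • ones) (y := x)
    (fun j => by rw [smul_ones_apply]; exact (abs_le.1 (hx j)).1) i
  rw [apply_smul_ones] at h1 h2
  have h3 := mul_le_mul_of_nonneg_left (h i) (norm_nonneg x)
  rw [Real.norm_eq_abs, abs_le]
  constructor <;> linarith

/-- A right inverse of `1 - U` is positive when `U` is positive with `U 𝟙 ≤ c 𝟙`, `c < 1`. -/
lemma OpPos.of_one_sub_mul_eq_one {U B : Linf →L[ℝ] Linf} (hU : OpPos U) {c : ℝ} (hc : c < 1)
    (h : ∀ i, U ones i ≤ c) (hB : (1 - U) * B = 1) : OpPos B := by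
  intro x hx
  have hy : ∀ i, B x i = x i + U (B x) i := fun i => by
    have h1 : ((1 - U) * B) x i = x i := by rw [hB]; rfl
    have h2 : ((1 - U) * B) x i = B x i - U (B x) i := rfl
    linarith
  have hbdd : BddBelow (Set.range (B x)) :=
    ⟨-‖B x‖, by rintro _ ⟨j, rfl⟩; exact (abs_le.1 ((B x).norm_coe_le_norm j)).1⟩
  set s : ℝ := ⨅ j, B x j
  have hle : ∀ j, s ≤ B x j := fun j => ciInf_le hbdd j
  suffices 0 ≤ s from fun i => this.trans (hle i)
  by_contra! hneg
  have hcs : c * s ≤ s := le_ciInf fun i => by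
    have h1 := hU.apply_le (x := s • ones) (y := B x)
      (fun j => by rw [smul_ones_apply]; exact hle j) i
    rw [apply_smul_ones] at h1
    have := mul_le_mul_of_nonpos_right (h i) hneg.le
    linarith [hy i, hx i]
  nlinarith

lemma OpPos.isUnit_one_sub {U : Linf →L[ℝ] Linf} (hU : OpPos U) {c : ℝ} (hc : c < 1)
    (h : ∀ i, U ones i ≤ c) : IsUnit (1 - U) :=
  isUnit_one_sub_of_norm_lt_one (R := Linf →L[ℝ] Linf) ((hU.norm_le h).trans_lt hc)

/-- The resolvent identity `C - B = C (V - U) B` for inverses of `1 - V` and `1 - U`. -/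
lemma inverse_sub_inverse {R : Type*} [Ring R] {U V B C : R} (hB : (1 - U) * B = 1)
    (hC : C * (1 - V) = 1) : C - B = C * (V - U) * B := by
  calc C - B = C * ((1 - U) * B) - (C * (1 - V)) * B := by rw [hB, hC, mul_one, one_mul]
    _ = C * (V - U) * B := by noncomm_ring

lemma inverse_mul_sub_inverse_mul {R : Type*} [Ring R] {A D E X Y B C : R}
    (hB : (1 - (A + D * X)) * B = 1) (hC : C * (1 - (A + D * Y)) = 1) :
    C * E - B * E = C * D * (Y - X) * (B * E) := by
  rw [← sub_mul, inverse_sub_inverse hB hC]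
  noncomm_ring

lemma eq_inverse_mul_of_quadratic {R : Type*} [Ring R] {A D E G C : R}
    (h : D * G ^ 2 + A * G + E = G) (hC : C * (1 - (A + D * G)) = 1) : G = C * E := by
  have hE : E = (1 - (A + D * G)) * G := by
    rw [eq_sub_of_add_eq' h]
    noncomm_ring
  rw [hE, ← mul_assoc, hC, one_mul]

lemma tendsto_zero_of_le_mul {a : ℕ → ℝ} {r : ℝ} (hr : 0 ≤ r) (hr1 : r < 1)
    (ha : ∀ k, 0 ≤ a k) (h : ∀ k, a (k + 1) ≤ r * a k) : Tendsto a atTop (nhds 0) := by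
  have hgeom : ∀ k, a k ≤ r ^ k * a 0 := fun k => by
    induction k with
    | zero => simp
    | succ k ih =>
      calc a (k + 1) ≤ r * a k := h k
        _ ≤ r * (r ^ k * a 0) := mul_le_mul_of_nonneg_left ih hr
        _ = r ^ (k + 1) * a 0 := by ring
  refine squeeze_zero ha hgeom ?_
  simpa using (tendsto_pow_atTop_nhds_zero_of_lt_one hr hr1).mul_const (a 0)

/-- Fixed point iteration F₃: there is a unique sequence with X₀ = 0 and
X_{k+1} = (I - A₀ - A₁X_k)⁻¹A₋₁, and it converges monotonically and linearly to G. -/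
theorem stmt2
    (Am1 A0 A1 G : Linf →L[ℝ] Linf)
    (hAm1 : OpPos Am1) (hA0 : OpPos A0) (hA1 : OpPos A1) (hG : OpPos G)
    (hstoch : (Am1 + A0 + A1) ones = ones)
    (heq : A1 * G ^ 2 + A0 * G + Am1 = G)
    (hG1 : G ones = ones)
    (σ : ℝ) (hσ : σ < 1)
    (hgap : ∀ i, 1 - σ ≤ ((Am1 - A1) ones) i) :
    (∃! X : ℕ → Linf →L[ℝ] Linf,
        X 0 = 0 ∧ ∀ k, ∃ B : Linf →L[ℝ] Linf,
          (1 - A0 - A1 * X k) * B = 1 ∧ B * (1 - A0 - A1 * X k) = 1 ∧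
          X (k + 1) = B * Am1) ∧
    ∀ X : ℕ → Linf →L[ℝ] Linf,
      (X 0 = 0 ∧ ∀ k, ∃ B : Linf →L[ℝ] Linf,
          (1 - A0 - A1 * X k) * B = 1 ∧ B * (1 - A0 - A1 * X k) = 1 ∧
          X (k + 1) = B * Am1) →
      (∀ k, OpPos (X k) ∧ OpPos (X (k + 1) - X k) ∧ OpPos (G - X k)) ∧
      (∃ C : Linf →L[ℝ] Linf, (1 - A0 - A1 * G) * C = 1 ∧ C * (1 - A0 - A1 * G) = 1 ∧
        ∀ k, ‖G - X (k + 1)‖ ≤ ‖C * A1‖ * ‖G - X k‖) ∧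
      Tendsto (fun k => ‖G - X k‖) atTop (nhds 0) := by
  have hs : ∀ i, Am1 ones i + A0 ones i + A1 ones i = 1 := fun i =>
    congrArg (fun x : Linf => x i) hstoch
  have hg : ∀ i, 1 - σ ≤ Am1 ones i - A1 ones i := hgap
  have hone : ∀ i, ones i = 1 := fun _ => rfl
  have hassoc : ∀ X : Linf →L[ℝ] Linf, 1 - A0 - A1 * X = 1 - (A0 + A1 * X) := fun X =>
    sub_sub (α := Linf →L[ℝ] Linf) _ _ _
  simp only [hassoc]
  have hUpos : ∀ X, OpPos X → OpPos (A0 + A1 * X) := fun X hX => hA0.add (hA1.mul hX)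
  have hXones : ∀ X, OpPos (G - X) → ∀ i, X ones i ≤ ones i := fun X hX i => by
    have h : 0 ≤ G ones i - X ones i := hX ones vnonneg_ones i
    rw [hG1] at h
    linarith
  have hUones : ∀ X, OpPos (G - X) → ∀ i, (A0 + A1 * X) ones i ≤ σ := fun X hX i => by
    have h1 : A1 (X ones) i ≤ A1 ones i := hA1.apply_le (hXones X hX) i
    have h2 : (A0 + A1 * X) ones i = A0 ones i + A1 (X ones) i := rfl
    have h3 := hA1 ones vnonneg_ones i
    linarith [hs i, hg i]
  have hGG : OpPos (G - G) := fun x _ i => (sub_self (G x i)).ge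
  obtain ⟨u, hu⟩ := (hUpos G hG).isUnit_one_sub hσ (hUones G hGG)
  set C : Linf →L[ℝ] Linf := ↑u⁻¹
  have hC1 : (1 - (A0 + A1 * G)) * C = 1 := by rw [← hu]; exact u.mul_inv
  have hC2 : C * (1 - (A0 + A1 * G)) = 1 := by rw [← hu]; exact u.inv_mul
  have hCpos : OpPos C := (hUpos G hG).of_one_sub_mul_eq_one hσ (hUones G hGG) hC1
  have hCG : G = C * Am1 := eq_inverse_mul_of_quadratic (R := Linf →L[ℝ] Linf) heq hC2
  have herr : ∀ X B, (1 - (A0 + A1 * X)) * B = 1 →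
      G - B * Am1 = C * A1 * (G - X) * (B * Am1) := fun X B hB => by
    have h : C * Am1 - B * Am1 = C * A1 * (G - X) * (B * Am1) :=
      inverse_mul_sub_inverse_mul (R := Linf →L[ℝ] Linf) hB hC2
    rwa [← hCG] at h
  have hstep : ∀ X B, OpPos X → OpPos (G - X) → (1 - (A0 + A1 * X)) * B = 1 →
      OpPos B ∧ OpPos (B * Am1) ∧ OpPos (G - B * Am1) := fun X B hX hGX hB => by
    have hBpos := (hUpos X hX).of_one_sub_mul_eq_one hσ (hUones X hGX) hB
    refine ⟨hBpos, hBpos.mul hAm1, ?_⟩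
    rw [herr X B hB]
    exact ((hCpos.mul hA1).mul hGX).mul (hBpos.mul hAm1)
  have hzero : OpPos (0 : Linf →L[ℝ] Linf) := fun x _ i => le_refl _
  refine ⟨?_, ?_⟩
  · let X : ℕ → Linf →L[ℝ] Linf := fun k =>
      Nat.rec 0 (fun _ Y => Ring.inverse (1 - (A0 + A1 * Y)) * Am1) k
    have hinv : ∀ Y, OpPos Y → OpPos (G - Y) →
        (1 - (A0 + A1 * Y)) * Ring.inverse (1 - (A0 + A1 * Y)) = 1 ∧
        Ring.inverse (1 - (A0 + A1 * Y)) * (1 - (A0 + A1 * Y)) = 1 := fun Y hY hGY => by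
      have h := (hUpos Y hY).isUnit_one_sub hσ (hUones Y hGY)
      exact ⟨Ring.mul_inverse_cancel _ h, Ring.inverse_mul_cancel _ h⟩
    have hX : ∀ k, OpPos (X k) ∧ OpPos (G - X k) := fun k => by
      induction k with
      | zero => exact ⟨hzero, hG.sub_zero⟩
      | succ k ih => exact (hstep (X k) _ ih.1 ih.2 (hinv _ ih.1 ih.2).1).2
    refine ⟨X, ⟨rfl, fun k => ⟨_, (hinv _ (hX k).1 (hX k).2).1, (hinv _ (hX k).1 (hX k).2).2,
      rfl⟩⟩, ?_⟩
    rintro Y ⟨hY0, hY⟩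
    funext k
    induction k with
    | zero => exact hY0
    | succ k ih =>
      obtain ⟨B, hB1, -, hB⟩ := hY k
      rw [ih] at hB1
      rw [hB, ← left_inv_eq_right_inv (hinv _ (hX k).1 (hX k).2).2 hB1]
  · rintro X ⟨hX0, hX⟩
    choose B hB1 hB2 hB using hX
    have hpos : ∀ k, OpPos (X k) ∧ OpPos (G - X k) := fun k => by
      induction k with
      | zero => rw [hX0]; exact ⟨hzero, hG.sub_zero⟩
      | succ k ih => rw [hB k]; exact (hstep (X k) _ ih.1 ih.2 (hB1 k)).2
    have hBpos : ∀ k, OpPos (B k) := fun k =>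
      (hstep (X k) _ (hpos k).1 (hpos k).2 (hB1 k)).1
    have hmono : ∀ k, OpPos (X (k + 1) - X k) := fun k => by
      induction k with
      | zero => rw [hX0]; exact (hpos _).1.sub_zero
      | succ k ih =>
        have h : X (k + 1 + 1) - X (k + 1) =
            B (k + 1) * A1 * (X (k + 1) - X k) * X (k + 1) := by
          have h' := inverse_mul_sub_inverse_mul (R := Linf →L[ℝ] Linf) (E := Am1)
            (hB1 k) (hB2 (k + 1))
          rwa [← hB k, ← hB (k + 1)] at h'
        rw [h]
        exact (((hBpos _).mul hA1).mul ih).mul (hpos _).1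
    have hlin : ∀ k, ‖G - X (k + 1)‖ ≤ ‖C * A1‖ * ‖G - X k‖ := fun k => by
      have h1 : ‖X (k + 1)‖ ≤ 1 := (hpos _).1.norm_le (hXones _ (hpos _).2)
      calc ‖G - X (k + 1)‖ = ‖C * A1 * (G - X k) * X (k + 1)‖ := by
            rw [hB k, herr (X k) (B k) (hB1 k)]
        _ ≤ ‖C * A1 * (G - X k)‖ * ‖X (k + 1)‖ := ContinuousLinearMap.opNorm_comp_le _ _
        _ ≤ ‖C * A1 * (G - X k)‖ := mul_le_of_le_one_right (ContinuousLinearMap.opNorm_nonneg _) h1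
        _ ≤ _ := ContinuousLinearMap.opNorm_comp_le _ _
    have hrate : ‖C * A1‖ ≤ σ := by
      refine (hCpos.mul hA1).norm_le fun i => ?_
      have hCge : ∀ i, 1 ≤ C ones i := fun i => by
        have h1 : ((1 - (A0 + A1 * G)) * C) ones i = 1 := by rw [hC1]; rfl
        have h2 : ((1 - (A0 + A1 * G)) * C) ones i =
          C ones i - (A0 + A1 * G) (C ones) i := rfl
        linarith [hUpos G hG _ (hCpos _ vnonneg_ones) i]
      have hCm : C (Am1 ones) = ones := by
        change (C * Am1) ones = ones
        rw [← hCG, hG1]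
      have h1 := hCpos.apply_le (x := A1 ones + (1 - σ) • ones) (y := Am1 ones) (fun j => by
        rw [BoundedContinuousFunction.add_apply, smul_ones_apply]; linarith [hg j]) i
      rw [hCm, map_add, BoundedContinuousFunction.add_apply, apply_smul_ones, hone] at h1
      change C (A1 ones) i ≤ σ
      nlinarith [hCge i]
    refine ⟨fun k => ⟨(hpos k).1, hmono k, (hpos k).2⟩, ⟨C, hC1, hC2, hlin⟩,
      tendsto_zero_of_le_mul (ContinuousLinearMap.opNorm_nonneg _) (hrate.trans_lt hσ)
        (fun _ => ContinuousLinearMap.opNorm_nonneg _) hlin⟩
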